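/- arXiv:1510.01748 — 2 statements merged into one kernel-verified Lean document; each statement's English description precedes it below -/
import Mathlib

section
/- Let X₀, X₁, Y₀, Y₁ ⊂ ℝ^{2n} be an admissible quadruple of nonempty compact sets and let κ > 0. Suppose the pair (Y₀, Y₁) autonomously κ-interlinks the pair (X₀, X₁), i.e., every smooth complete autonomous Hamiltonian G : ℝ^{2n} → ℝ with Δ := min_{Y₁} G − max_{Y₀} G > 0 admits a Hamiltonian chord from X₀ to X₁ of time-length at most κ/Δ. Then for all compactly supported smooth F, G : ℝ^{2n} → ℝ with F ≤ 0 on X₀, F ≥ 1 on X₁, G ≤ 0 on Y₀, G ≥ 1 on Y₁, one has sup_{ℝ^{2n}} {F,G} ≥ 1/κ; equivalently, pb₄⁺(X₀, X₁, Y₀, Y₁) ≥ 1/κ. -/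
open Real Set

noncomputable section

/-- `ℝ^n` as a function type. -/
abbrev Vec (n : ℕ) := Fin n → ℝ

/-- The phase space `ℝ^{2n} = ℝ^n(p) × ℝ^n(q)`. -/
abbrev Phase (n : ℕ) := Vec n × Vec n

/-- Euclidean norm on `ℝ^n`. -/
def eucNorm {n : ℕ} (x : Vec n) : ℝ := Real.sqrt (∑ i, x i ^ 2)

/-- The vector of partial derivatives of `f` at `x`. -/
def gradVec {n : ℕ} (f : Vec n → ℝ) (x : Vec n) : Vec n :=
  fun i => fderiv ℝ f x (Pi.single i 1)

/-- The Poisson bracket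
`{F,G} = Σᵢ (∂F/∂qᵢ·∂G/∂pᵢ − ∂F/∂pᵢ·∂G/∂qᵢ)` of the standard symplectic form `dp∧dq`. -/
def poisson {n : ℕ} (F G : Phase n → ℝ) (x : Phase n) : ℝ :=
  ∑ i, (fderiv ℝ (fun q => F (x.1, q)) x.2 (Pi.single i 1) *
          fderiv ℝ (fun p => G (p, x.2)) x.1 (Pi.single i 1) -
        fderiv ℝ (fun p => F (p, x.2)) x.1 (Pi.single i 1) *
          fderiv ℝ (fun q => G (x.1, q)) x.2 (Pi.single i 1))

/-- The class of test pairs `(F, G)` for `pb₄`: compactly supported smooth functions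
with `F ≤ 0` on `X₀`, `F ≥ 1` on `X₁`, `G ≤ 0` on `Y₀`, `G ≥ 1` on `Y₁`. -/
def pbAdmissible {n : ℕ} (X₀ X₁ Y₀ Y₁ : Set (Phase n)) (F G : Phase n → ℝ) : Prop :=
  ContDiff ℝ (⊤ : ℕ∞) F ∧ HasCompactSupport F ∧ ContDiff ℝ (⊤ : ℕ∞) G ∧ HasCompactSupport G ∧
  (∀ x ∈ X₀, F x ≤ 0) ∧ (∀ x ∈ X₁, 1 ≤ F x) ∧
  (∀ y ∈ Y₀, G y ≤ 0) ∧ (∀ y ∈ Y₁, 1 ≤ G y)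

/-- The Poisson bracket invariant `pb₄⁺ = inf sup_{ℝ^{2n}} {F,G}`. -/
def pb4pos {n : ℕ} (X₀ X₁ Y₀ Y₁ : Set (Phase n)) : ℝ :=
  sInf {c | ∃ F G : Phase n → ℝ, pbAdmissible X₀ X₁ Y₀ Y₁ F G ∧
    c = sSup (Set.range (poisson F G))}

/-- `γ` solves Hamilton's equations of the autonomous Hamiltonian `G` at every `t ∈ S`. -/
def IsAutHamSolOn {n : ℕ} (G : Phase n → ℝ) (γ : ℝ → Phase n) (S : Set ℝ) : Prop :=
  ∀ t ∈ S,
    HasDerivAt (fun s => (γ s).1) (-(gradVec (fun q => G ((γ t).1, q)) (γ t).2)) t ∧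
    HasDerivAt (fun s => (γ s).2) (gradVec (fun p => G (p, (γ t).2)) (γ t).1) t

/-- An autonomous Hamiltonian is complete if through every point there is a globally
defined solution. -/
def AutHamComplete {n : ℕ} (G : Phase n → ℝ) : Prop :=
  ∀ x₀ : Phase n, ∃ γ : ℝ → Phase n, γ 0 = x₀ ∧ IsAutHamSolOn G γ Set.univ

/-- The partial derivative in `p` as a directional derivative on phase space. -/
lemma fderiv_momentum_apply {n : ℕ} {F : Phase n → ℝ} (hF : Differentiable ℝ F) (x : Phase n)
    (v : Vec n) : fderiv ℝ (fun p => F (p, x.2)) x.1 v = fderiv ℝ F x (v, 0) := by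
  have h := (hF x).hasFDerivAt.comp x.1 (hasFDerivAt_prodMk_left (𝕜 := ℝ) x.1 x.2)
  have h' : HasFDerivAt (fun p => F (p, x.2)) _ x.1 := h
  rw [h'.fderiv]
  rfl

/-- The partial derivative in `q` as a directional derivative on phase space. -/
lemma fderiv_position_apply {n : ℕ} {F : Phase n → ℝ} (hF : Differentiable ℝ F) (x : Phase n)
    (v : Vec n) : fderiv ℝ (fun q => F (x.1, q)) x.2 v = fderiv ℝ F x (0, v) := by
  have h := (hF x).hasFDerivAt.comp x.2 (hasFDerivAt_prodMk_right (𝕜 := ℝ) x.1 x.2)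
  have h' : HasFDerivAt (fun q => F (x.1, q)) _ x.2 := h
  rw [h'.fderiv]
  rfl

/-- The Hamiltonian vector field of `G`. -/
def hamVectorField {n : ℕ} (G : Phase n → ℝ) (x : Phase n) : Phase n :=
  (fun i => -fderiv ℝ G x (0, Pi.single i 1), fun i => fderiv ℝ G x (Pi.single i 1, 0))

lemma poisson_eq_fderiv_hamVectorField {n : ℕ} {F G : Phase n → ℝ} (hF : Differentiable ℝ F)
    (hG : Differentiable ℝ G) (x : Phase n) :
    poisson F G x = fderiv ℝ F x (hamVectorField G x) := by
  have hsplit : hamVectorField G x = ∑ i : Fin n,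
      ((-fderiv ℝ G x (0, Pi.single i 1)) • ((Pi.single i 1, 0) : Phase n) +
        fderiv ℝ G x (Pi.single i 1, 0) • ((0, Pi.single i 1) : Phase n)) := by
    ext j
    · simp [hamVectorField, Prod.fst_sum, Pi.single_apply]
    · simp [hamVectorField, Prod.snd_sum, Pi.single_apply]
  rw [hsplit, map_sum]
  unfold poisson
  refine Finset.sum_congr rfl fun i _ => ?_
  simp only [fderiv_momentum_apply hF, fderiv_momentum_apply hG, fderiv_position_apply hF,
    fderiv_position_apply hG, map_add, map_smul, smul_eq_mul]
  ring

lemma isAutHamSolOn_iff {n : ℕ} {G : Phase n → ℝ} (hG : Differentiable ℝ G) (γ : ℝ → Phase n)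
    (S : Set ℝ) :
    IsAutHamSolOn G γ S ↔ ∀ t ∈ S, HasDerivAt γ (hamVectorField G (γ t)) t := by
  have h₁ (x : Phase n) :
      (hamVectorField G x).1 = -(gradVec (fun q => G (x.1, q)) x.2) := by
    ext i
    simp [hamVectorField, gradVec, fderiv_position_apply hG]
  have h₂ (x : Phase n) :
      (hamVectorField G x).2 = gradVec (fun p => G (p, x.2)) x.1 := by
    ext i
    simp [hamVectorField, gradVec, fderiv_momentum_apply hG]
  refine forall₂_congr fun t _ => ?_
  rw [← h₁, ← h₂]
  exact ⟨fun h => h.1.prodMk h.2,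
    fun h => ⟨(hasFDerivAt_fst (p := γ t)).comp_hasDerivAt t h,
      (hasFDerivAt_snd (p := γ t)).comp_hasDerivAt t h⟩⟩

lemma contDiff_hamVectorField {n : ℕ} {G : Phase n → ℝ} (hG : ContDiff ℝ (⊤ : ℕ∞) G) :
    ContDiff ℝ 1 (hamVectorField G) := by
  have h : ContDiff ℝ 1 (fderiv ℝ G) := (contDiff_infty.1 hG 2).fderiv_right (by norm_num)
  exact (contDiff_pi.2 fun i => (h.clm_apply contDiff_const).neg).prodMk
    (contDiff_pi.2 fun i => h.clm_apply contDiff_const)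

lemma hasCompactSupport_hamVectorField {n : ℕ} {G : Phase n → ℝ} (hG : HasCompactSupport G) :
    HasCompactSupport (hamVectorField G) := by
  refine (hG.fderiv ℝ).mono fun x hx => ?_
  contrapose! hx
  rw [Function.notMem_support] at hx ⊢
  simp only [hamVectorField, hx]
  ext <;> simp

open scoped Manifold in
/-- A compactly supported `C¹` vector field on a complete normed space has global integral
curves. -/
lemma exists_integralCurve_of_hasCompactSupport {E : Type*} [NormedAddCommGroup E]
    [NormedSpace ℝ E] [CompleteSpace E] {v : E → E} (hv : ContDiff ℝ 1 v)
    (hc : HasCompactSupport v) (x₀ : E) :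
    ∃ γ : ℝ → E, γ 0 = x₀ ∧ ∀ t, HasDerivAt γ (v (γ t)) t := by
  obtain ⟨K, hK⟩ := hv.lipschitzWith_of_hasCompactSupport hc one_ne_zero
  obtain ⟨L, hL⟩ := hc.exists_bound_of_continuous hv.continuous
  have hL0 : 0 ≤ L := (norm_nonneg _).trans (hL x₀)
  have hsec : ContMDiff 𝓘(ℝ, E) 𝓘(ℝ, E).tangent 1
      (fun x ↦ (⟨x, v x⟩ : TangentBundle 𝓘(ℝ, E) E)) :=
    contMDiff_vectorSpace_iff_contDiff.2 hv
  have hloc (x : E) : ∃ γ : ℝ → E, γ 0 = x ∧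
      IsMIntegralCurveOn (I := 𝓘(ℝ, E)) γ v (Ioo (-1) 1) := by
    have hpl : IsPicardLindelof (fun _ => v) (tmin := -1) (tmax := 1) ⟨0, by simp⟩ x
        ⟨L, hL0⟩ 0 ⟨L, hL0⟩ K :=
      { lipschitzOnWith := fun _ _ => hK.lipschitzOnWith
        continuousOn := fun _ _ => continuousOn_const
        norm_le := fun _ _ y _ => hL y
        mul_max_le := by simp }
    obtain ⟨α, hα0, hα⟩ := hpl.exists_eq_forall_mem_Icc_hasDerivWithinAt₀
    exact ⟨α, hα0, fun t ht => hasMFDerivWithinAt_iff_hasFDerivWithinAt.2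
      ((hα t (Ioo_subset_Icc_self ht)).mono Ioo_subset_Icc_self).hasFDerivWithinAt⟩
  obtain ⟨γ, h0, hγ⟩ := exists_isMIntegralCurve_of_isMIntegralCurveOn hsec one_pos hloc x₀
  refine ⟨γ, h0, fun t => ?_⟩
  rw [hasDerivAt_iff_hasFDerivAt]
  exact hasMFDerivAt_iff_hasFDerivAt.1 (hγ t)

lemma autHamComplete_of_hasCompactSupport {n : ℕ} {G : Phase n → ℝ}
    (hG : ContDiff ℝ (⊤ : ℕ∞) G) (hc : HasCompactSupport G) : AutHamComplete G := fun x₀ => by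
  obtain ⟨γ, h0, hγ⟩ := exists_integralCurve_of_hasCompactSupport (contDiff_hamVectorField hG)
    (hasCompactSupport_hamVectorField hc) x₀
  exact ⟨γ, h0, (isAutHamSolOn_iff (hG.differentiable (by simp)) γ univ).2 fun t _ => hγ t⟩

lemma bddAbove_range_poisson {n : ℕ} {F G : Phase n → ℝ} (hF : ContDiff ℝ (⊤ : ℕ∞) F)
    (hFc : HasCompactSupport F) (hG : ContDiff ℝ (⊤ : ℕ∞) G) :
    BddAbove (range (poisson F G)) := by
  have heq : poisson F G = fun x => fderiv ℝ F x (hamVectorField G x) :=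
    funext (poisson_eq_fderiv_hamVectorField (hF.differentiable (by simp))
      (hG.differentiable (by simp)))
  rw [heq]
  refine Continuous.bddAbove_range_of_hasCompactSupport
    ((hF.continuous_fderiv (by simp)).clm_apply (contDiff_hamVectorField hG).continuous)
    ((hFc.fderiv ℝ).mono fun x hx => ?_)
  contrapose! hx
  rw [Function.notMem_support] at hx ⊢
  simp [hx]

/-- Along a Hamiltonian trajectory of `G`, the function `F` grows at rate at most `sup {F,G}`. -/
lemma sub_le_sSup_poisson_mul {n : ℕ} {F G : Phase n → ℝ} (hF : ContDiff ℝ (⊤ : ℕ∞) F)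
    (hFc : HasCompactSupport F) (hG : ContDiff ℝ (⊤ : ℕ∞) G) {γ : ℝ → Phase n} {a b : ℝ}
    (hab : a ≤ b) (hγ : IsAutHamSolOn G γ (Icc a b)) :
    F (γ b) - F (γ a) ≤ sSup (range (poisson F G)) * (b - a) := by
  have hFd : Differentiable ℝ F := hF.differentiable (by simp)
  have hGd : Differentiable ℝ G := hG.differentiable (by simp)
  have hder : ∀ t ∈ Icc a b, HasDerivAt (F ∘ γ) (poisson F G (γ t)) t := fun t ht => by
    rw [poisson_eq_fderiv_hamVectorField hFd hGd]
    exact (hFd _).hasFDerivAt.comp_hasDerivAt t ((isAutHamSolOn_iff hGd γ _).1 hγ t ht)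
  refine (convex_Icc a b).image_sub_le_mul_sub_of_deriv_le (f := F ∘ γ)
    (fun t ht => (hder t ht).continuousAt.continuousWithinAt)
    (fun t ht => (hder t (interior_subset ht)).differentiableAt.differentiableWithinAt)
    (fun t ht => ?_) a (left_mem_Icc.2 hab) b (right_mem_Icc.2 hab) hab
  rw [(hder t (interior_subset ht)).deriv]
  exact le_csSup (bddAbove_range_poisson hF hFc hG) (mem_range_self _)

open scoped Manifold in
/-- Disjoint compact sets are separated by a compactly supported smooth function. -/
lemma exists_contDiff_hasCompactSupport_separating {E : Type*} [NormedAddCommGroup E]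
    [NormedSpace ℝ E] [FiniteDimensional ℝ E] {A B : Set E} (hA : IsCompact A)
    (hB : IsCompact B) (hAB : Disjoint A B) :
    ∃ f : E → ℝ, ContDiff ℝ (⊤ : ℕ∞) f ∧ HasCompactSupport f ∧ (∀ x ∈ A, f x = 0) ∧
      ∀ x ∈ B, f x = 1 := by
  have hopen : IsOpen (Metric.thickening 1 B ∩ Aᶜ) :=
    Metric.isOpen_thickening.inter hA.isClosed.isOpen_compl
  obtain ⟨f, hf, -, hsupp, hone⟩ := exists_contMDiff_support_eq_eq_one_iff 𝓘(ℝ, E) hopen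
    hB.isClosed (subset_inter (Metric.self_subset_thickening one_pos B)
      hAB.symm.subset_compl_right)
  refine ⟨f, hf.contDiff, ?_, fun x hx => ?_, fun x hx => (hone x).1 hx⟩
  · have : ProperSpace E := FiniteDimensional.proper ℝ E
    refine HasCompactSupport.of_support_subset_isCompact
      (hB.isBounded.thickening (δ := 1)).isCompact_closure ?_
    rw [hsupp]
    exact inter_subset_left.trans subset_closure
  · rw [← Function.notMem_support, hsupp]
    exact fun h => h.2 hx

/-- the easy inequality of Theorem 1.11: if `(Y₀,Y₁)` autonomously
`κ`-interlinks `(X₀,X₁)`, then for every admissible test pair `(F,G)` one has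
`sup {F,G} ≥ 1/κ`; consequently `pb₄⁺(X₀,X₁,Y₀,Y₁) ≥ 1/κ`. -/
theorem stmt_9 (n : ℕ) (X₀ X₁ Y₀ Y₁ : Set (Phase n))
    (hX₀ : IsCompact X₀) (hX₁ : IsCompact X₁) (hY₀ : IsCompact Y₀) (hY₁ : IsCompact Y₁)
    (hX₀ne : X₀.Nonempty) (hX₁ne : X₁.Nonempty) (hY₀ne : Y₀.Nonempty)
    (hY₁ne : Y₁.Nonempty)
    (hXdisj : Disjoint X₀ X₁) (hYdisj : Disjoint Y₀ Y₁)
    (κ : ℝ) (hκ : 0 < κ)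
    (hinter : ∀ G : Phase n → ℝ, ContDiff ℝ (⊤ : ℕ∞) G → AutHamComplete G →
      0 < sInf (G '' Y₁) - sSup (G '' Y₀) →
      ∃ (t₀ τ : ℝ) (γ : ℝ → Phase n),
        0 < τ ∧ τ ≤ κ / (sInf (G '' Y₁) - sSup (G '' Y₀)) ∧
        IsAutHamSolOn G γ (Icc t₀ (t₀ + τ)) ∧ γ t₀ ∈ X₀ ∧ γ (t₀ + τ) ∈ X₁) :
    (∀ F G : Phase n → ℝ, pbAdmissible X₀ X₁ Y₀ Y₁ F G →
      1 / κ ≤ sSup (Set.range (poisson F G))) ∧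
    1 / κ ≤ pb4pos X₀ X₁ Y₀ Y₁ := by
  have hbound : ∀ F G : Phase n → ℝ, pbAdmissible X₀ X₁ Y₀ Y₁ F G →
      1 / κ ≤ sSup (Set.range (poisson F G)) := by
    rintro F G ⟨hF, hFc, hG, hGc, hFX₀, hFX₁, hGY₀, hGY₁⟩
    have hgap : 1 ≤ sInf (G '' Y₁) - sSup (G '' Y₀) := by
      have h₀ : sSup (G '' Y₀) ≤ 0 := csSup_le (hY₀ne.image G) (forall_mem_image.2 hGY₀)
      have h₁ : 1 ≤ sInf (G '' Y₁) := le_csInf (hY₁ne.image G) (forall_mem_image.2 hGY₁)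
      linarith
    obtain ⟨t₀, τ, γ, hτ, hτκ, hγ, h₀, h₁⟩ :=
      hinter G hG (autHamComplete_of_hasCompactSupport hG hGc) (one_pos.trans_le hgap)
    have hgrowth := sub_le_sSup_poisson_mul hF hFc hG (by linarith) hγ
    rw [add_sub_cancel_left] at hgrowth
    have hone : 1 ≤ sSup (range (poisson F G)) * τ := by
      linarith [hFX₀ _ h₀, hFX₁ _ h₁]
    have hpos : 0 < sSup (range (poisson F G)) :=
      pos_of_mul_pos_left (one_pos.trans_le hone) hτ.le
    rw [div_le_iff₀ hκ]
    exact hone.trans (mul_le_mul_of_nonneg_left (hτκ.trans (div_le_self hκ.le hgap)) hpos.le)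
  obtain ⟨F, hF, hFc, hF₀, hF₁⟩ := exists_contDiff_hasCompactSupport_separating hX₀ hX₁ hXdisj
  obtain ⟨G, hG, hGc, hG₀, hG₁⟩ := exists_contDiff_hasCompactSupport_separating hY₀ hY₁ hYdisj
  refine ⟨hbound, le_csInf ⟨_, F, G, ⟨hF, hFc, hG, hGc, fun x hx => (hF₀ x hx).le,
    fun x hx => (hF₁ x hx).ge, fun x hx => (hG₀ x hx).le, fun x hx => (hG₁ x hx).ge⟩, rfl⟩ ?_⟩
  rintro c ⟨F, G, hFG, rfl⟩
  exact hbound F G hFG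
end
end

section
/- Let k ≥ 1, 0 < R₀ < R₁, 0 < T < π/2 and c > 0. Let u : ℝ → ℝ be smooth with 0 ≤ u'(s) ≤ c for all s, and consider the autonomous Hamiltonian G(p, q) := u(|p|² + |q|²) on ℝ^{2k}. Then every solution γ of Hamilton's equations of G defined on an interval [t₀, t₁] with γ(t₀) ∈ 𝓗 := {(s·u, 0) : |u| = 1, s ∈ [√R₀, √R₁]} and γ(t₁) ∈ 𝓛_T := {(s·cos(2T)·u, s·sin(2T)·u) : |u| = 1, s ∈ [√R₀, √R₁]} satisfies t₁ − t₀ ≥ T/c. (In particular a radial Hamiltonian with u' ≤ (R₁−R₀)^{-1} on [R₀, R₁] has no chords from the high wall to the low wall of time-length less than T(R₁−R₀).) -/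
open Real Set

noncomputable section

/-- The wall at angle `θ`: `{(s·cos θ·u, s·sin θ·u) : |u| = 1, s ∈ [√R₀, √R₁]}`. -/
def sphereWallAt (k : ℕ) (R₀ R₁ θ : ℝ) : Set (Phase k) :=
  {x | ∃ (u : Vec k) (s : ℝ), eucNorm u = 1 ∧ s ∈ Icc (Real.sqrt R₀) (Real.sqrt R₁) ∧
        x = ((s * Real.cos θ) • u, (s * Real.sin θ) • u)}

/-- Partial derivatives of `x ↦ u (a + ∑ i, x i ^ 2)`. -/
lemma gradVec_comp_add_sum_sq {k : ℕ} {u : ℝ → ℝ} (hu : Differentiable ℝ u) (a : ℝ)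
    (x : Vec k) (j : Fin k) :
    gradVec (fun x : Vec k => u (a + ∑ i, x i ^ 2)) x j
      = 2 * deriv u (a + ∑ i, x i ^ 2) * x j := by
  have hsq : HasFDerivAt (fun x : Vec k => a + ∑ i, x i ^ 2)
      (∑ i, (2 * x i) • ContinuousLinearMap.proj (R := ℝ) (φ := fun _ : Fin k => ℝ) i) x := by
    refine HasFDerivAt.const_add a (HasFDerivAt.fun_sum fun i _ => ?_)
    simpa using (hasFDerivAt_apply (𝕜 := ℝ) i x).pow 2
  have h := (hu _).hasDerivAt.comp_hasFDerivAt x hsq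
  change fderiv ℝ (u ∘ fun x : Vec k => a + ∑ i, x i ^ 2) x (Pi.single j 1) = _
  rw [h.fderiv]
  simp [Pi.single_apply]
  ring

/-- A function with vanishing derivative on `[a, b]` is constant there. -/
lemma eq_left_of_hasDerivAt_zero {f : ℝ → ℝ} {a b : ℝ}
    (h : ∀ t ∈ Icc a b, HasDerivAt f 0 t) : ∀ t ∈ Icc a b, f t = f a :=
  constant_of_has_deriv_right_zero (fun t ht => (h t ht).continuousAt.continuousWithinAt)
    fun t ht => (h t (Ico_subset_Icc_self ht)).hasDerivWithinAt

/-- Hamilton's equations of the radial Hamiltonian `u (|p|² + |q|²)` in coordinates. -/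
lemma IsAutHamSolOn.hasDerivAt_radial {k : ℕ} {u : ℝ → ℝ} (hu : Differentiable ℝ u)
    {γ : ℝ → Phase k} {S : Set ℝ}
    (hγ : IsAutHamSolOn (fun x : Phase k => u (∑ i, x.1 i ^ 2 + ∑ i, x.2 i ^ 2)) γ S)
    {t : ℝ} (ht : t ∈ S) (j : Fin k) :
    HasDerivAt (fun s => (γ s).1 j)
      (-(2 * deriv u (∑ i, (γ t).1 i ^ 2 + ∑ i, (γ t).2 i ^ 2) * (γ t).2 j)) t ∧
    HasDerivAt (fun s => (γ s).2 j)
      (2 * deriv u (∑ i, (γ t).1 i ^ 2 + ∑ i, (γ t).2 i ^ 2) * (γ t).1 j) t := by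
  obtain ⟨hp, hq⟩ := hγ t ht
  refine ⟨(hasDerivAt_pi.1 hp j).congr_deriv ?_, (hasDerivAt_pi.1 hq j).congr_deriv ?_⟩
  · exact congrArg Neg.neg (gradVec_comp_add_sum_sq hu (∑ i, (γ t).1 i ^ 2) (γ t).2 j)
  · simp only [add_comm (∑ i, _ ^ 2) (∑ i, (γ t).2 i ^ 2)]
    exact gradVec_comp_add_sum_sq hu _ _ j

/-- A radial Hamiltonian flow preserves `|p|² + |q|²`. -/
lemma IsAutHamSolOn.normSq_eq_left {k : ℕ} {u : ℝ → ℝ} (hu : Differentiable ℝ u)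
    {γ : ℝ → Phase k} {a b : ℝ}
    (hγ : IsAutHamSolOn (fun x : Phase k => u (∑ i, x.1 i ^ 2 + ∑ i, x.2 i ^ 2)) γ (Icc a b)) :
    ∀ t ∈ Icc a b, ∑ i, (γ t).1 i ^ 2 + ∑ i, (γ t).2 i ^ 2
      = ∑ i, (γ a).1 i ^ 2 + ∑ i, (γ a).2 i ^ 2 := by
  refine eq_left_of_hasDerivAt_zero
    (f := fun t => ∑ i, (γ t).1 i ^ 2 + ∑ i, (γ t).2 i ^ 2) fun t ht => ?_
  have h := (HasDerivAt.fun_sum (u := Finset.univ)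
    fun i _ => (hγ.hasDerivAt_radial hu ht i).1.fun_pow 2).add
    (HasDerivAt.fun_sum (u := Finset.univ)
      fun i _ => (hγ.hasDerivAt_radial hu ht i).2.fun_pow 2)
  refine h.congr_deriv ?_
  rw [← Finset.sum_add_distrib]
  refine Finset.sum_eq_zero fun i _ => ?_
  push_cast
  ring

/-- A radial Hamiltonian flow rotates every coordinate plane at constant angular speed. -/
lemma IsAutHamSolOn.cos_mul_sub_sin_mul_eq {k : ℕ} {u : ℝ → ℝ} (hu : Differentiable ℝ u)
    {γ : ℝ → Phase k} {a b : ℝ}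
    (hγ : IsAutHamSolOn (fun x : Phase k => u (∑ i, x.1 i ^ 2 + ∑ i, x.2 i ^ 2)) γ (Icc a b))
    (j : Fin k) {t : ℝ} (ht : t ∈ Icc a b) :
    Real.cos (2 * deriv u (∑ i, (γ a).1 i ^ 2 + ∑ i, (γ a).2 i ^ 2) * (t - a)) * (γ t).2 j
      - Real.sin (2 * deriv u (∑ i, (γ a).1 i ^ 2 + ∑ i, (γ a).2 i ^ 2) * (t - a)) * (γ t).1 j
      = (γ a).2 j := by
  set v := 2 * deriv u (∑ i, (γ a).1 i ^ 2 + ∑ i, (γ a).2 i ^ 2) with hv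
  have key := eq_left_of_hasDerivAt_zero (a := a) (b := b)
    (f := fun t => Real.cos (v * (t - a)) * (γ t).2 j - Real.sin (v * (t - a)) * (γ t).1 j)
    (fun t ht => ?_) t ht
  · simpa using key
  · obtain ⟨hp, hq⟩ := hγ.hasDerivAt_radial hu ht j
    rw [hγ.normSq_eq_left hu t ht, ← hv] at hp hq
    have hθ : HasDerivAt (fun t => v * (t - a)) v t := by
      simpa using ((hasDerivAt_id t).sub_const a).const_mul v
    refine ((hθ.cos.mul hq).sub (hθ.sin.mul hp)).congr_deriv ?_
    ring

/-- step 1 of the proof of Theorem 5.2: a radial Hamiltonian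
`G = u(|p|² + |q|²)` with `0 ≤ u' ≤ c` has no chord from the high wall `𝓗` to the low
wall `𝓛_T` of time-length less than `T/c`. -/
theorem stmt_17 (k : ℕ) (hk : 1 ≤ k) (R₀ R₁ T c : ℝ) (hR₀ : 0 < R₀) (hR : R₀ < R₁)
    (hT₀ : 0 < T) (hT : T < π / 2) (hc : 0 < c)
    (u : ℝ → ℝ) (hu : ContDiff ℝ (⊤ : ℕ∞) u)
    (hu' : ∀ s : ℝ, 0 ≤ deriv u s ∧ deriv u s ≤ c)
    (G : Phase k → ℝ) (hG : G = fun x => u (∑ i, x.1 i ^ 2 + ∑ i, x.2 i ^ 2))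
    (t₀ t₁ : ℝ) (ht : t₀ ≤ t₁) (γ : ℝ → Phase k)
    (hγ : IsAutHamSolOn G γ (Icc t₀ t₁))
    (h₀ : γ t₀ ∈ sphereWallAt k R₀ R₁ 0)
    (h₁ : γ t₁ ∈ sphereWallAt k R₀ R₁ (2 * T)) :
    T / c ≤ t₁ - t₀ := by
  subst hG
  have hud : Differentiable ℝ u := hu.differentiable (by simp)
  obtain ⟨_, _, -, -, hγ₀⟩ := h₀
  obtain ⟨w, s, hw, hs, hγ₁⟩ := h₁
  have hrot := fun j => hγ.cos_mul_sub_sin_mul_eq hud j (right_mem_Icc.2 ht)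
  obtain ⟨hv₀, hvc⟩ := hu' (∑ i, (γ t₀).1 i ^ 2 + ∑ i, (γ t₀).2 i ^ 2)
  set v := deriv u (∑ i, (γ t₀).1 i ^ 2 + ∑ i, (γ t₀).2 i ^ 2)
  have hs_pos : 0 < s := (Real.sqrt_pos.2 hR₀).trans_le hs.1
  rw [div_le_iff₀ hc]
  by_contra! hlt
  have hτ : 0 ≤ t₁ - t₀ := sub_nonneg.2 ht
  have hvτ : v * (t₁ - t₀) < T :=
    (mul_le_mul_of_nonneg_right hvc hτ).trans_lt (by rwa [mul_comm])
  have hsin : 0 < Real.sin (2 * T - 2 * v * (t₁ - t₀)) := by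
    have := mul_nonneg hv₀ hτ
    exact Real.sin_pos_of_pos_of_lt_pi (by linarith) (by linarith)
  have hw₀ : ∀ j, w j = 0 := by
    intro j
    have hj := hrot j
    simp only [hγ₁, hγ₀, Pi.smul_apply, smul_eq_mul, Real.sin_zero, mul_zero, zero_mul] at hj
    have : Real.sin (2 * T - 2 * v * (t₁ - t₀)) * s * w j = 0 := by
      rw [Real.sin_sub]
      linear_combination hj
    simpa [hsin.ne', hs_pos.ne'] using this
  simp [eucNorm, hw₀] at hw
end
end
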